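/- Let p = (p_x, p_y), v = (v_x, v_y) ∈ ℝ² with v ≠ 0, let d > 0, and define g = v_x²·(p_y² − d²) + v_y²·(p_x² − d²) − 2·v_x·v_y·p_x·p_y. If g ≥ 0, then ‖p + t·v‖ ≥ d for all t ∈ ℝ. -/

import Mathlib

/-- If the time-invariant separation function `g` is nonnegative, the aircraft pair
is separated (at distance at least `d`) at every time `t ∈ ℝ`. -/
theorem g_nonneg_implies_separation
    (p v : EuclideanSpace ℝ (Fin 2)) (hv : v ≠ 0) (d : ℝ) (hd : 0 < d)
    (g : ℝ)
    (hg : g = (v 0) ^ 2 * ((p 1) ^ 2 - d ^ 2) + (v 1) ^ 2 * ((p 0) ^ 2 - d ^ 2)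
        - 2 * (v 0) * (v 1) * (p 0) * (p 1))
    (hgpos : g ≥ 0) :
    ∀ t : ℝ, ‖p + t • v‖ ≥ d := by
  intro t
  have hv_pos : 0 < (v 0) ^ 2 + (v 1) ^ 2 := by
    have h : 0 < ‖v‖ ^ 2 := by positivity
    simpa [EuclideanSpace.norm_sq_eq, Fin.sum_univ_two] using h
  have hnorm : ‖p + t • v‖ ^ 2 = (p 0 + t * v 0) ^ 2 + (p 1 + t * v 1) ^ 2 := by
    simp [EuclideanSpace.norm_sq_eq, Fin.sum_univ_two]
  refine (sq_le_sq₀ hd.le (norm_nonneg _)).mp ?_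
  rw [hnorm]
  refine le_of_mul_le_mul_left ?_ hv_pos
  linarith [sq_nonneg ((p 0 + t * v 0) * v 0 + (p 1 + t * v 1) * v 1)]
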